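/- Let m > 0, ν ∈ (0, 1/m], λ ≤ 0, and let c > 0 satisfy (1 − 2λ)·J_ν(2c/m) + 2c·J′_ν(2c/m) = 0 with 2c/m ∈ (0, j_ν). Let a < b and let f be absolutely continuous on [a, b] with f(a) = f(b) = 0 and f′/δ ∈ L¹[a, b]. Then ((1 − ν²m²)/4)·∫ₐᵇ |f(x)|/δ(x)² dx + (c²/δ₀^m)·∫ₐᵇ |f(x)|/δ(x)^{2−m} dx ≤ ((1 + νm)/2)·∫ₐᵇ |f′(x)|/δ(x) dx − (λ/δ₀)·∫ₐᵇ |f′(x)| dx. -/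

import Mathlib

open MeasureTheory Real Set Filter

/-- Bessel function of the first kind of real order `ν`, defined for `x > 0` by its series. -/
noncomputable def besselJ (ν x : ℝ) : ℝ :=
  ∑' k : ℕ, (-1 : ℝ) ^ k * x ^ (2 * (k : ℝ) + ν) /
    (2 ^ (2 * (k : ℝ) + ν) * (Nat.factorial k : ℝ) * Real.Gamma ((k : ℝ) + 1 + ν))

/-- The entire function `H_ν` with `J_ν(x) = (x / 2) ^ ν * H_ν(x ^ 2 / 4)`. -/
noncomputable def besselH (ν s : ℝ) : ℝ :=
  ∑' k : ℕ, (-s) ^ k / ((Nat.factorial k : ℝ) * Real.Gamma ((k : ℝ) + 1 + ν))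

theorem Gamma_le_Gamma_natCast_add {ν : ℝ} (hν : 0 ≤ ν) (k : ℕ) :
    Real.Gamma (1 + ν) ≤ Real.Gamma ((k : ℝ) + 1 + ν) := by
  induction k with
  | zero => simp
  | succ k ih =>
    have hk : (0 : ℝ) ≤ k := k.cast_nonneg
    have hpos : 0 < Real.Gamma ((k : ℝ) + 1 + ν) := Real.Gamma_pos_of_pos (by linarith)
    have h : Real.Gamma (((k + 1 : ℕ) : ℝ) + 1 + ν)
        = ((k : ℝ) + 1 + ν) * Real.Gamma ((k : ℝ) + 1 + ν) := by
      rw [← Real.Gamma_add_one (by linarith)]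
      push_cast
      ring_nf
    rw [h]
    nlinarith

theorem abs_besselH_term_le {ν : ℝ} (hν : 0 ≤ ν) {s R : ℝ} (hs : |s| ≤ R) (k : ℕ) :
    |(-s) ^ k / ((Nat.factorial k : ℝ) * Real.Gamma ((k : ℝ) + 1 + ν))|
      ≤ R ^ k / (Nat.factorial k : ℝ) * (Real.Gamma (1 + ν))⁻¹ := by
  have h0 : 0 < Real.Gamma (1 + ν) := Real.Gamma_pos_of_pos (by linarith)
  have h1 := Gamma_le_Gamma_natCast_add hν k
  have hk : (0 : ℝ) < Nat.factorial k := by positivity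
  have hR : 0 ≤ R := (abs_nonneg s).trans hs
  rw [abs_div, abs_pow, abs_neg, abs_of_pos (mul_pos hk (h0.trans_le h1)), ← div_eq_mul_inv,
    div_div]
  gcongr

theorem summable_besselH {ν : ℝ} (hν : 0 ≤ ν) (s : ℝ) :
    Summable fun k : ℕ =>
      (-s) ^ k / ((Nat.factorial k : ℝ) * Real.Gamma ((k : ℝ) + 1 + ν)) :=
  Summable.of_norm_bounded ((Real.summable_pow_div_factorial |s|).mul_right _)
    fun k => abs_besselH_term_le hν le_rfl k

theorem hasDerivAt_besselH_term {ν : ℝ} (hν : 0 ≤ ν) (k : ℕ) (s : ℝ) :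
    HasDerivAt (fun s : ℝ =>
        (-s) ^ (k + 1) / ((Nat.factorial (k + 1) : ℝ) * Real.Gamma (((k + 1 : ℕ) : ℝ) + 1 + ν)))
      (-((-s) ^ k / ((Nat.factorial k : ℝ) * Real.Gamma ((k : ℝ) + 1 + (ν + 1))))) s := by
  have h := (((hasDerivAt_id s).neg.pow (k + 1)).div_const
    ((Nat.factorial (k + 1) : ℝ) * Real.Gamma (((k + 1 : ℕ) : ℝ) + 1 + ν)))
  refine h.congr_deriv ?_
  have hG : Real.Gamma ((k : ℝ) + 1 + (ν + 1)) = Real.Gamma (((k + 1 : ℕ) : ℝ) + 1 + ν) := by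
    push_cast
    ring_nf
  have hpos : 0 < Real.Gamma (((k + 1 : ℕ) : ℝ) + 1 + ν) := Real.Gamma_pos_of_pos (by positivity)
  rw [hG, Nat.factorial_succ]
  have hk : (0 : ℝ) < Nat.factorial k := by positivity
  push_cast at hpos ⊢
  simp only [id, Pi.neg_apply]
  field_simp

theorem besselH_eq_zero_add {ν : ℝ} (hν : 0 ≤ ν) (s : ℝ) :
    besselH ν s = (Real.Gamma (1 + ν))⁻¹ + ∑' k : ℕ,
      (-s) ^ (k + 1) / ((Nat.factorial (k + 1) : ℝ) * Real.Gamma (((k + 1 : ℕ) : ℝ) + 1 + ν)) := by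
  rw [besselH, (summable_besselH hν s).tsum_eq_zero_add]
  simp

theorem hasDerivAt_besselH {ν : ℝ} (hν : 0 ≤ ν) (s : ℝ) :
    HasDerivAt (besselH ν) (-besselH (ν + 1) s) s := by
  have hν' : 0 ≤ ν + 1 := by linarith
  have hs : s ∈ Metric.ball (0 : ℝ) (|s| + 1) := by simp
  have h := hasDerivAt_tsum_of_isPreconnected
    ((Real.summable_pow_div_factorial (|s| + 1)).mul_right (Real.Gamma (1 + (ν + 1)))⁻¹)
    Metric.isOpen_ball (convex_ball (0 : ℝ) (|s| + 1)).isPreconnected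
    (fun k y _ => hasDerivAt_besselH_term hν k y)
    (fun k y hy => by
      rw [norm_neg]
      exact abs_besselH_term_le hν' (by simpa using (mem_ball_zero_iff.1 hy).le) k)
    hs ((summable_nat_add_iff 1).2 (summable_besselH hν s)) hs
  have h2 := h.const_add (Real.Gamma (1 + ν))⁻¹
  rw [tsum_neg] at h2
  exact h2.congr_of_eventuallyEq (Eventually.of_forall fun y => besselH_eq_zero_add hν y)

theorem besselH_recurrence {ν : ℝ} (hν : 0 ≤ ν) (s : ℝ) :
    besselH ν s = (ν + 1) * besselH (ν + 1) s - s * besselH (ν + 2) s := by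
  have hν1 : 0 ≤ ν + 1 := by linarith
  have hν2 : 0 ≤ ν + 2 := by linarith
  have hG1 : Real.Gamma (1 + (ν + 1)) = (ν + 1) * Real.Gamma (1 + ν) := by
    rw [← add_comm (ν + 1) 1, Real.Gamma_add_one (by linarith), add_comm ν 1]
  have hpos0 : 0 < Real.Gamma (1 + ν) := Real.Gamma_pos_of_pos (by linarith)
  have hsum : ∑' k : ℕ, (-s) ^ (k + 1) /
        ((Nat.factorial (k + 1) : ℝ) * Real.Gamma (((k + 1 : ℕ) : ℝ) + 1 + ν))
      = (ν + 1) * (∑' k : ℕ, (-s) ^ (k + 1) /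
        ((Nat.factorial (k + 1) : ℝ) * Real.Gamma (((k + 1 : ℕ) : ℝ) + 1 + (ν + 1))))
        - s * besselH (ν + 2) s := by
    rw [besselH, ← tsum_mul_left, ← tsum_mul_left, ← Summable.tsum_sub
      (((summable_nat_add_iff 1).2 (summable_besselH hν1 s)).mul_left _)
      ((summable_besselH hν2 s).mul_left _)]
    refine tsum_congr fun k => ?_
    have hp : 0 < (k : ℝ) + 2 + ν := by positivity
    have hA : Real.Gamma (((k + 1 : ℕ) : ℝ) + 1 + (ν + 1))
        = ((k : ℝ) + 2 + ν) * Real.Gamma ((k : ℝ) + 2 + ν) := by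
      rw [← Real.Gamma_add_one hp.ne']
      push_cast
      ring_nf
    have hB : Real.Gamma ((k : ℝ) + 1 + (ν + 2))
        = ((k : ℝ) + 2 + ν) * Real.Gamma ((k : ℝ) + 2 + ν) := by
      rw [← Real.Gamma_add_one hp.ne']
      ring_nf
    have hC : Real.Gamma (((k + 1 : ℕ) : ℝ) + 1 + ν) = Real.Gamma ((k : ℝ) + 2 + ν) := by
      push_cast
      ring_nf
    have hpos : 0 < Real.Gamma ((k : ℝ) + 2 + ν) := Real.Gamma_pos_of_pos hp
    have hk : (0 : ℝ) < Nat.factorial k := by positivity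
    rw [hA, hB, hC, Nat.factorial_succ, pow_succ]
    push_cast
    field_simp
    ring
  rw [besselH_eq_zero_add hν, besselH_eq_zero_add hν1, hsum, hG1]
  have : ν + 1 ≠ 0 := by linarith
  field_simp
  ring

theorem besselJ_eq_rpow_mul_besselH (ν : ℝ) {x : ℝ} (hx : 0 < x) :
    besselJ ν x = (x / 2) ^ ν * besselH ν (x ^ 2 / 4) := by
  rw [besselJ, besselH, ← tsum_mul_left]
  refine tsum_congr fun k => ?_
  have e1 : x ^ (2 * (k : ℝ) + ν) = (x ^ 2) ^ k * x ^ ν := by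
    rw [Real.rpow_add hx, Real.rpow_mul hx.le, Real.rpow_natCast, Real.rpow_two]
  have e2 : (2 : ℝ) ^ (2 * (k : ℝ) + ν) = 4 ^ k * 2 ^ ν := by
    rw [Real.rpow_add two_pos, Real.rpow_mul two_pos.le, Real.rpow_natCast, Real.rpow_two]
    norm_num
  rw [e1, e2, Real.div_rpow hx.le two_pos.le, neg_pow (x ^ 2 / 4), div_pow]
  simp only [div_eq_mul_inv, mul_inv]
  ring

theorem mul_deriv_besselJ {ν : ℝ} (hν : 0 ≤ ν) {x : ℝ} (hx : 0 < x) :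
    x * deriv (besselJ ν) x = (x / 2) ^ ν *
      (ν * besselH ν (x ^ 2 / 4) - 2 * (x ^ 2 / 4) * besselH (ν + 1) (x ^ 2 / 4)) := by
  have hH : HasDerivAt (fun y : ℝ => besselH ν (y ^ 2 / 4))
      (-besselH (ν + 1) (x ^ 2 / 4) * (2 * x / 4)) x := by
    have := ((hasDerivAt_pow 2 x).div_const 4)
    exact (hasDerivAt_besselH hν (x ^ 2 / 4)).comp x (by simpa using this)
  have hP : HasDerivAt (fun y : ℝ => (y / 2) ^ ν) (1 / 2 * ν * (x / 2) ^ (ν - 1)) x :=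
    ((hasDerivAt_id x).div_const 2).rpow_const (Or.inl (by simpa using hx.ne'))
  have hJ : HasDerivAt (besselJ ν) _ x := (hP.mul hH).congr_of_eventuallyEq
    ((eventually_gt_nhds hx).mono fun y hy => besselJ_eq_rpow_mul_besselH ν hy)
  rw [hJ.deriv, Real.rpow_sub_one (by positivity)]
  field_simp
  ring

theorem besselH_add_one_nonneg {ν S : ℝ} (hν : 0 ≤ ν)
    (hpos : ∀ s ∈ Ioo 0 S, 0 < besselH ν s) {s : ℝ} (hs : s ∈ Ioo 0 S) :
    0 ≤ besselH (ν + 1) s := by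
  have hν1 : 0 ≤ ν + 1 := by linarith
  have hmono : MonotoneOn (fun y : ℝ => y ^ (ν + 1) * besselH (ν + 1) y) (Icc 0 s) := by
    refine monotoneOn_of_hasDerivWithinAt_nonneg (f' := fun y => y ^ ν * besselH ν y)
      (convex_Icc 0 s) ?_ ?_ ?_
    · refine ContinuousOn.mul (Real.continuous_rpow_const hν1).continuousOn ?_
      exact fun y _ => (hasDerivAt_besselH hν1 y).continuousAt.continuousWithinAt
    · intro y hy
      rw [interior_Icc] at hy
      have h := ((Real.hasDerivAt_rpow_const (p := ν + 1) (Or.inl hy.1.ne')).mul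
        (hasDerivAt_besselH hν1 y))
      refine (h.congr_deriv ?_).hasDerivWithinAt
      rw [besselH_recurrence hν y, Real.rpow_add_one hy.1.ne', add_sub_cancel_right,
        show ν + 1 + 1 = ν + 2 by ring]
      ring
    · intro y hy
      rw [interior_Icc] at hy
      exact mul_nonneg (Real.rpow_nonneg hy.1.le _) (hpos y ⟨hy.1, hy.2.trans hs.2⟩).le
  have h := hmono (left_mem_Icc.2 hs.1.le) (right_mem_Icc.2 hs.1.le) hs.1.le
  simp only [Real.zero_rpow (by linarith : ν + 1 ≠ 0), zero_mul] at h
  exact nonneg_of_mul_nonneg_right h (Real.rpow_pos_of_pos hs.1 _)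

/-- The Riccati equation for the logarithmic derivative of `H_ν`. -/
theorem hasDerivAt_besselH_ratio {ν s : ℝ} (hν : 0 ≤ ν) (hs : s ≠ 0) (hH : besselH ν s ≠ 0) :
    HasDerivAt (fun s => s * besselH (ν + 1) s / besselH ν s)
      ((s - ν * (s * besselH (ν + 1) s / besselH ν s)
        + (s * besselH (ν + 1) s / besselH ν s) ^ 2) / s) s := by
  have h := ((hasDerivAt_id s).mul (hasDerivAt_besselH (by linarith : 0 ≤ ν + 1) s)).div
    (hasDerivAt_besselH hν s) hH
  refine h.congr_deriv ?_
  have hr := besselH_recurrence hν s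
  simp only [id, show ν + 1 + 1 = ν + 2 by ring, Pi.mul_apply]
  have hr2 : s * besselH (ν + 2) s = (ν + 1) * besselH (ν + 1) s - besselH ν s := by linarith
  field_simp
  linear_combination (-besselH ν s) * hr2

theorem integral_hardy_weight_le {m ν lam c S L t : ℝ} (hm : 0 < m) (hν : 0 ≤ ν) (hc : 0 < c)
    (hpos : ∀ s ∈ Ioo 0 S, 0 < besselH ν s) (hcS : c ^ 2 / m ^ 2 < S)
    (hroot : (1 + ν * m) / 2
      - m * (c ^ 2 / m ^ 2 * besselH (ν + 1) (c ^ 2 / m ^ 2) / besselH ν (c ^ 2 / m ^ 2)) = lam)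
    (ht : 0 < t) (htL : t ≤ L) :
    ∫ x in t..L, ((1 - ν ^ 2 * m ^ 2) / 4 / x ^ 2 + c ^ 2 / L ^ m / x ^ ((2 : ℝ) - m))
      ≤ (1 + ν * m) / 2 / t - lam / L := by
  have hL : 0 < L := ht.trans_le htL
  set r : ℝ → ℝ := fun s => s * besselH (ν + 1) s / besselH ν s with hr
  set q : ℝ → ℝ := fun x => c ^ 2 / m ^ 2 * (x / L) ^ m with hq
  have hσ : 0 < c ^ 2 / m ^ 2 := by positivity
  have hqmem : ∀ x, 0 < x → x ≤ L → q x ∈ Ioo 0 S := by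
    intro x hx hxL
    refine ⟨by positivity, lt_of_le_of_lt ?_ hcS⟩
    have : (x / L) ^ m ≤ 1 :=
      Real.rpow_le_one (by positivity) ((div_le_one hL).2 hxL) hm.le
    exact mul_le_of_le_one_right hσ.le this
  have hrnonneg : ∀ s ∈ Ioo 0 S, 0 ≤ r s := fun s hs =>
    div_nonneg (mul_nonneg hs.1.le (besselH_add_one_nonneg hν hpos hs)) (hpos s hs).le
  set W : ℝ → ℝ := fun x => ((1 + ν * m) / 2 - m * r (q x)) / x with hW
  have hderiv : ∀ x, 0 < x → x ≤ L → HasDerivAt (fun x => -W x)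
      (((1 + ν * m) / 2 - m * r (q x)) / x ^ 2
        + m ^ 2 * (q x - ν * r (q x) + r (q x) ^ 2) / x ^ 2) x := by
    intro x hx hxL
    have hmem := hqmem x hx hxL
    have hqd : HasDerivAt q (m * q x / x) x := by
      have h := (((hasDerivAt_id x).div_const L).rpow_const (p := m)
        (Or.inl (by simp only [id]; positivity))).const_mul (c ^ 2 / m ^ 2)
      refine h.congr_deriv ?_
      simp only [hq, id]
      rw [Real.rpow_sub_one (by positivity)]
      field_simp
    have hrd := (hasDerivAt_besselH_ratio hν hmem.1.ne' (hpos _ hmem).ne').comp x hqd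
    have h := ((((hrd.const_mul m).const_sub ((1 + ν * m) / 2))).div
      (hasDerivAt_id x) hx.ne').neg
    refine h.congr_deriv ?_
    have hq0 : q x ≠ 0 := hmem.1.ne'
    change _ = ((1 + ν * m) / 2 - m * (q x * besselH (ν + 1) (q x) / besselH ν (q x))) / x ^ 2
        + m ^ 2 * (q x - ν * (q x * besselH (ν + 1) (q x) / besselH ν (q x))
          + (q x * besselH (ν + 1) (q x) / besselH ν (q x)) ^ 2) / x ^ 2
    simp only [Function.comp_apply, id]
    generalize q x * besselH (ν + 1) (q x) / besselH ν (q x) = ρ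
    field_simp
    ring
  have hmain := intervalIntegral.integral_le_sub_of_hasDeriv_right_of_le (g := fun x => -W x)
    (φ := fun x => (1 - ν ^ 2 * m ^ 2) / 4 / x ^ 2 + c ^ 2 / L ^ m / x ^ ((2 : ℝ) - m)) htL
    (fun x hx => (hderiv x (ht.trans_le hx.1) hx.2).continuousAt.continuousWithinAt)
    (fun x hx => (hderiv x (ht.trans hx.1) hx.2.le).hasDerivWithinAt)
    (ContinuousOn.integrableOn_Icc (by
      refine ContinuousOn.add (continuousOn_const.div (by fun_prop) fun x hx => ?_)
        (continuousOn_const.div (continuousOn_id.rpow_const fun x hx => Or.inl ?_)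
          fun x hx => ?_)
      · exact (pow_pos (ht.trans_le hx.1) 2).ne'
      · exact (ht.trans_le hx.1).ne'
      · exact (Real.rpow_pos_of_pos (ht.trans_le hx.1) _).ne'))
    (fun x hx => by
      have hx0 : 0 < x := ht.trans hx.1
      have hE : c ^ 2 / L ^ m / x ^ ((2 : ℝ) - m) = m ^ 2 * q x / x ^ 2 := by
        simp only [hq]
        rw [Real.rpow_sub hx0, Real.rpow_two, Real.div_rpow hx0.le hL.le]
        field_simp
      have hsq : 0 ≤ ((1 + ν * m) / 2 - m * r (q x)) ^ 2 / x ^ 2 := by positivity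
      rw [hE]
      refine le_of_sub_nonneg (hsq.trans_eq ?_)
      ring)
  have hWL : W L = lam / L := by
    have : q L = c ^ 2 / m ^ 2 := by simp [hq, div_self hL.ne']
    simp only [hW, this, hr, hroot]
  have hWt : W t ≤ (1 + ν * m) / 2 / t := by
    have := hrnonneg _ (hqmem t ht htL)
    simp only [hW]
    gcongr
    nlinarith
  simp only [hWL] at hmain
  linarith

/-- Tonelli's theorem in the form of a weighted Hardy inequality with kernel `K`. -/
theorem lintegral_mul_le_of_kernel {μ : Measure ℝ} [SFinite μ] {K : Set (ℝ × ℝ)}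
    (hK : MeasurableSet K) {F G V B : ℝ → ENNReal} (hG : AEMeasurable G μ) (hV : Measurable V)
    (hF : ∀ᵐ x ∂μ, F x ≤ ∫⁻ t in {t | (x, t) ∈ K}, G t ∂μ)
    (hB : ∀ᵐ t ∂μ, ∫⁻ x in {x | (x, t) ∈ K}, V x ∂μ ≤ B t) :
    ∫⁻ x, F x * V x ∂μ ≤ ∫⁻ t, G t * B t ∂μ := by
  have hslice : ∀ x, MeasurableSet {t | (x, t) ∈ K} := fun x => hK.preimage (by fun_prop)
  have hslice' : ∀ t, MeasurableSet {x | (x, t) ∈ K} := fun t => hK.preimage (by fun_prop)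
  have hmeas : AEMeasurable (Function.uncurry fun x t : ℝ =>
      K.indicator (fun p : ℝ × ℝ => G p.2 * V p.1) (x, t)) (μ.prod μ) := by
    refine AEMeasurable.indicator ?_ hK
    exact (hG.comp_quasiMeasurePreserving Measure.quasiMeasurePreserving_snd).mul
      (hV.comp measurable_fst).aemeasurable
  calc ∫⁻ x, F x * V x ∂μ
      ≤ ∫⁻ x, ∫⁻ t, K.indicator (fun p : ℝ × ℝ => G p.2 * V p.1) (x, t) ∂μ ∂μ := by
        refine lintegral_mono_ae (hF.mono fun x hx => ?_)
        refine (mul_le_mul_left hx _).trans ?_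
        rw [← lintegral_indicator (hslice x),
          ← lintegral_mul_const'' _ (hG.indicator (hslice x))]
        refine le_of_eq (lintegral_congr fun t => ?_)
        by_cases h : (x, t) ∈ K <;> simp [indicator, h]
    _ = ∫⁻ t, ∫⁻ x, K.indicator (fun p : ℝ × ℝ => G p.2 * V p.1) (x, t) ∂μ ∂μ :=
        lintegral_lintegral_swap hmeas
    _ ≤ ∫⁻ t, G t * B t ∂μ := by
        refine lintegral_mono_ae (hB.mono fun t ht => ?_)
        refine le_trans (le_of_eq ?_) (mul_le_mul_right ht _)
        rw [← lintegral_indicator (hslice' t),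
          ← lintegral_const_mul _ (hV.indicator (hslice' t))]
        refine lintegral_congr fun x => ?_
        by_cases h : (x, t) ∈ K <;> simp [indicator, h]

theorem setLIntegral_ofReal_le_of_integral_le {v : ℝ → ℝ} {p d B : ℝ} (hpd : p ≤ d)
    (hv : ContinuousOn v (Icc p d)) (hv0 : ∀ x ∈ Icc p d, 0 ≤ v x)
    (hB : ∫ x in p..d, v x ≤ B) {s : Set ℝ} (hs : s ⊆ Ioc p d) :
    ∫⁻ x in s, ENNReal.ofReal (v x) ≤ ENNReal.ofReal B := by
  refine (lintegral_mono_set hs).trans ?_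
  rw [← ofReal_integral_eq_lintegral_ofReal
    ((hv.integrableOn_Icc).mono_set Ioc_subset_Icc_self)
    ((ae_restrict_iff' measurableSet_Ioc).2 (Eventually.of_forall fun x hx =>
      hv0 x (Ioc_subset_Icc_self hx))), ← intervalIntegral.integral_of_le hpd]
  exact ENNReal.ofReal_le_ofReal hB

/-- A one-dimensional Hardy-type inequality for an arbitrary weight `V` of the distance to the
boundary, given a bound `B` on the tail integrals of `V`. -/
theorem lintegral_mul_weight_dist_le {a b : ℝ} {f f' V B : ℝ → ℝ}
    (hV : Measurable V) (hVc : ContinuousOn V (Ioi 0)) (hV0 : ∀ x, 0 < x → 0 ≤ V x)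
    (hB : ∀ t, 0 < t → t ≤ (b - a) / 2 → ∫ x in t..(b - a) / 2, V x ≤ B t)
    (hf'int : IntegrableOn f' (Icc a b))
    (hf : ∀ x ∈ Icc a b, f x = ∫ t in a..x, f' t) (hfb : f b = 0) :
    ∫⁻ x in Ioo a b, ‖f x‖ₑ * ENNReal.ofReal (V (min (b - x) (x - a)))
      ≤ ∫⁻ t in Ioo a b, ‖f' t‖ₑ * ENNReal.ofReal (B (min (b - t) (t - a))) := by
  set d := (a + b) / 2 with hd
  set K : Set (ℝ × ℝ) := {p | (p.1 ≤ d ∧ p.2 < p.1) ∨ (d < p.1 ∧ p.1 ≤ p.2)}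
  have hK : MeasurableSet K :=
    ((measurableSet_le measurable_fst measurable_const).inter
      (measurableSet_lt measurable_snd measurable_fst)).union
    ((measurableSet_lt measurable_const measurable_fst).inter
      (measurableSet_le measurable_fst measurable_snd))
  have hslice : ∀ x, MeasurableSet {t | (x, t) ∈ K} := fun x => hK.preimage (by fun_prop)
  have hslice' : ∀ t, MeasurableSet {x | (x, t) ∈ K} := fun t => hK.preimage (by fun_prop)
  refine lintegral_mul_le_of_kernel hK ?_ ?_ ?_ ?_
  · exact (hf'int.mono_set Ioo_subset_Icc_self).aestronglyMeasurable.enorm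
  · exact (hV.comp (by fun_prop)).ennreal_ofReal
  · refine (ae_restrict_iff' measurableSet_Ioo).2 (Eventually.of_forall fun x hx => ?_)
    have hab : a ≤ b := (hx.1.trans hx.2).le
    have hint : ∀ u v, u ∈ Icc a b → v ∈ Icc a b → IntervalIntegrable f' volume u v :=
      fun u v hu hv => (hf'int.mono_set (uIcc_subset_Icc hu hv)).intervalIntegrable
    have hxI : x ∈ Icc a b := Ioo_subset_Icc_self hx
    have haI : a ∈ Icc a b := left_mem_Icc.2 hab
    have hbI : b ∈ Icc a b := right_mem_Icc.2 hab
    rcases le_or_gt x d with hxd | hxd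
    · rw [hf x hxI, intervalIntegral.integral_of_le hx.1.le, integral_Ioc_eq_integral_Ioo]
      refine (enorm_integral_le_lintegral_enorm _).trans ?_
      rw [Measure.restrict_restrict (hslice x)]
      refine lintegral_mono_set fun t ht => ⟨Or.inl ⟨hxd, ht.2⟩, ht.1, ht.2.trans hx.2⟩
    · have hfx : f x = -∫ t in x..b, f' t := by
        have := intervalIntegral.integral_add_adjacent_intervals (hint a x haI hxI)
          (hint x b hxI hbI)
        rw [← hf x hxI, ← hf b hbI, hfb] at this
        linarith
      rw [hfx, enorm_neg, intervalIntegral.integral_of_le hx.2.le,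
        integral_Ioc_eq_integral_Ioo]
      refine (enorm_integral_le_lintegral_enorm _).trans ?_
      rw [Measure.restrict_restrict (hslice x)]
      refine lintegral_mono_set fun t ht => ⟨Or.inr ⟨hxd, ht.1.le⟩, hx.1.trans ht.1, ht.2⟩
  · refine (ae_restrict_iff' measurableSet_Ioo).2 (Eventually.of_forall fun t ht => ?_)
    rw [Measure.restrict_restrict (hslice' t)]
    rcases le_or_gt t d with htd | htd
    · have hmin : ∀ x ≤ d, min (b - x) (x - a) = x - a := fun x hx =>
        min_eq_right (by linarith)
      have hset : ({x | (x, t) ∈ K} ∩ Ioo a b) ⊆ Ioc t d := by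
        rintro x ⟨h | h, -⟩
        · exact ⟨h.2, h.1⟩
        · exact absurd (h.1.trans_le h.2) (not_lt.2 htd)
      rw [hmin t htd]
      refine setLIntegral_ofReal_le_of_integral_le htd ?_ ?_ ?_ hset
      · refine ContinuousOn.congr (f := fun x => V (x - a)) ?_
          fun x hx => by simp only [hmin x hx.2]
        exact hVc.comp (by fun_prop) fun x hx => sub_pos.2 (ht.1.trans_le hx.1)
      · intro x hx
        rw [hmin x hx.2]
        exact hV0 _ (sub_pos.2 (ht.1.trans_le hx.1))
      · rw [intervalIntegral.integral_congr (g := fun x => V (x - a)) fun x hx => by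
          rw [uIcc_of_le htd] at hx
          simp only [hmin x hx.2], intervalIntegral.integral_comp_sub_right,
          show d - a = (b - a) / 2 by rw [hd]; ring]
        exact hB _ (sub_pos.2 ht.1) (by linarith)
    · have hmin : ∀ x, d ≤ x → min (b - x) (x - a) = b - x := fun x hx =>
        min_eq_left (by linarith)
      have hset : ({x | (x, t) ∈ K} ∩ Ioo a b) ⊆ Ioc d t := by
        rintro x ⟨h | h, -⟩
        · exact absurd (h.2.trans_le h.1) (not_lt.2 htd.le)
        · exact h
      rw [hmin t htd.le]
      refine setLIntegral_ofReal_le_of_integral_le htd.le ?_ ?_ ?_ hset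
      · refine ContinuousOn.congr (f := fun x => V (b - x)) ?_
          fun x hx => by simp only [hmin x hx.1]
        exact hVc.comp (by fun_prop) fun x hx => sub_pos.2 (hx.2.trans_lt ht.2)
      · intro x hx
        rw [hmin x hx.1]
        exact hV0 _ (sub_pos.2 (hx.2.trans_lt ht.2))
      · rw [intervalIntegral.integral_congr (g := fun x => V (b - x)) fun x hx => by
          rw [uIcc_of_le htd.le] at hx
          simp only [hmin x hx.1], intervalIntegral.integral_comp_sub_left,
          show b - d = (b - a) / 2 by rw [hd]; ring]
        exact hB _ (sub_pos.2 ht.2) (by linarith)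

theorem stmt_7 (m ν lam c jν a b : ℝ) (f f' : ℝ → ℝ)
    (hm : 0 < m) (hν : ν ∈ Set.Ioc 0 (1 / m))
    (hlam : lam ≤ 0)
    (hc : 0 < c)
    (hjν_pos : 0 < jν) (hjν_zero : besselJ ν jν = 0)
    (hjν_first : ∀ t ∈ Set.Ioo 0 jν, 0 < besselJ ν t)
    (hcm : 2 * c / m ∈ Set.Ioo 0 jν)
    (hroot : (1 - 2 * lam) * besselJ ν (2 * c / m)
      + 2 * c * deriv (besselJ ν) (2 * c / m) = 0)
    (hab : a < b)
    (hf'int : IntegrableOn f' (Set.Icc a b))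
    (hf : ∀ x ∈ Set.Icc a b, f x = ∫ t in a..x, f' t)
    (hfb : f b = 0)
    (hL1 : IntegrableOn (fun x => f' x / min (b - x) (x - a)) (Set.Ioo a b)) :
    (1 - ν ^ 2 * m ^ 2) / 4 * (∫ x in Set.Ioo a b, |f x| / (min (b - x) (x - a)) ^ 2)
      + c ^ 2 / ((b - a) / 2) ^ m *
        (∫ x in Set.Ioo a b, |f x| / (min (b - x) (x - a)) ^ ((2:ℝ) - m))
    ≤ (1 + ν * m) / 2 * (∫ x in Set.Ioo a b, |f' x| / min (b - x) (x - a))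
      - lam / ((b - a) / 2) * (∫ x in Set.Ioo a b, |f' x|) := by
  obtain ⟨hν0, hν1⟩ := hν
  have hL : 0 < (b - a) / 2 := by linarith
  have hνm : ν * m ≤ 1 := (le_div_iff₀ hm).1 hν1
  have hνm0 : 0 < ν * m := mul_pos hν0 hm
  have hpos : ∀ s ∈ Ioo 0 (jν ^ 2 / 4), 0 < besselH ν s := by
    rintro s ⟨hs, hsj⟩
    have hx : 0 < 2 * √s := by positivity
    have hsq : (2 * √s) ^ 2 / 4 = s := by
      rw [mul_pow, Real.sq_sqrt hs.le]
      ring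
    have hJ := hjν_first (2 * √s) ⟨hx, lt_of_pow_lt_pow_left₀ 2 hjν_pos.le (by linarith)⟩
    rw [besselJ_eq_rpow_mul_besselH ν hx, hsq] at hJ
    exact pos_of_mul_pos_right hJ (by positivity)
  have hσ : (2 * c / m) ^ 2 / 4 = c ^ 2 / m ^ 2 := by ring
  have hcS : c ^ 2 / m ^ 2 < jν ^ 2 / 4 := by
    rw [← hσ]
    have := pow_lt_pow_left₀ hcm.2 hcm.1.le two_ne_zero
    linarith
  have hroot' : (1 + ν * m) / 2
      - m * (c ^ 2 / m ^ 2 * besselH (ν + 1) (c ^ 2 / m ^ 2) / besselH ν (c ^ 2 / m ^ 2))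
      = lam := by
    have hH : 0 < besselH ν (c ^ 2 / m ^ 2) := hpos _ ⟨by positivity, hcS⟩
    have hd := mul_deriv_besselJ hν0.le hcm.1
    have hrw : 2 * c * deriv (besselJ ν) (2 * c / m)
        = m * (2 * c / m * deriv (besselJ ν) (2 * c / m)) := by field_simp
    rw [hrw, hd, besselJ_eq_rpow_mul_besselH ν hcm.1, hσ] at hroot
    have hz : (2 * c / m / 2) ^ ν ≠ 0 := (Real.rpow_pos_of_pos (half_pos hcm.1) ν).ne'
    have hroot2 : (1 - 2 * lam) * besselH ν (c ^ 2 / m ^ 2)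
        + m * (ν * besselH ν (c ^ 2 / m ^ 2)
          - 2 * (c ^ 2 / m ^ 2) * besselH (ν + 1) (c ^ 2 / m ^ 2)) = 0 := by
      refine (mul_eq_zero.1 (?_ : (2 * c / m / 2) ^ ν * _ = 0)).resolve_left hz
      linarith
    generalize c ^ 2 / m ^ 2 = σ at *
    field_simp
    linarith
  have hC1 : 0 ≤ (1 - ν ^ 2 * m ^ 2) / 4 := by nlinarith
  have hC2 : 0 < c ^ 2 / ((b - a) / 2) ^ m := by positivity
  have hδ : ∀ x ∈ Ioo a b, 0 < min (b - x) (x - a) := fun x hx =>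
    lt_min (sub_pos.2 hx.2) (sub_pos.2 hx.1)
  have hfm : AEStronglyMeasurable f (volume.restrict (Ioo a b)) := by
    have hcont : ContinuousOn f (Icc a b) :=
      (intervalIntegral.continuousOn_primitive_interval (by rwa [uIcc_of_le hab.le])).congr
        (by rw [uIcc_of_le hab.le]; exact hf) |>.mono (by rw [uIcc_of_le hab.le])
    exact (hcont.mono Ioo_subset_Icc_self).aestronglyMeasurable measurableSet_Ioo
  set δ : ℝ → ℝ := fun x => min (b - x) (x - a) with hδdef
  set V : ℝ → ℝ := fun x =>
    (1 - ν ^ 2 * m ^ 2) / 4 / x ^ 2 + c ^ 2 / ((b - a) / 2) ^ m / x ^ ((2 : ℝ) - m) with hV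
  set B : ℝ → ℝ := fun t => (1 + ν * m) / 2 / t - lam / ((b - a) / 2) with hB
  have hδm : Measurable δ := by fun_prop
  have hVm : Measurable V := by fun_prop
  have hV0 : ∀ x, 0 < x → 0 ≤ V x := fun x hx => by positivity
  have hB0 : ∀ t, 0 < t → 0 ≤ B t := fun t ht =>
    sub_nonneg.2 ((div_nonpos_of_nonpos_of_nonneg hlam hL.le).trans (by positivity))
  have hVc : ContinuousOn V (Ioi 0) := by
    refine ContinuousOn.add (continuousOn_const.div (by fun_prop) fun x hx => ?_)
      (continuousOn_const.div (continuousOn_id.rpow_const fun x hx => Or.inl ?_) fun x hx => ?_)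
    · exact (pow_pos hx 2).ne'
    · exact (mem_Ioi.1 hx).ne'
    · exact (Real.rpow_pos_of_pos hx _).ne'
  have hlint := lintegral_mul_weight_dist_le hVm hVc hV0
    (fun t ht htL => integral_hardy_weight_le hm hν0.le hc hpos hcS hroot' ht htL)
    hf'int hf hfb
  have hf'I : IntegrableOn (fun x => |f' x|) (Ioo a b) :=
    (hf'int.mono_set Ioo_subset_Icc_self).abs
  have hf'δ : IntegrableOn (fun x => |f' x| / δ x) (Ioo a b) :=
    IntegrableOn.congr_fun hL1.abs (fun x hx => by
      simp only [abs_div, abs_of_pos (hδ x hx), hδdef]) measurableSet_Ioo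
  have hrhs : ∀ x, |f' x| * B (δ x)
      = (1 + ν * m) / 2 * (|f' x| / δ x) - lam / ((b - a) / 2) * |f' x| := fun x => by
    simp only [hB]
    ring
  have hRint : IntegrableOn (fun x => |f' x| * B (δ x)) (Ioo a b) := by
    simp only [hrhs]
    exact (hf'δ.const_mul _).sub (hf'I.const_mul _)
  have hR : ∫ x in Ioo a b, |f' x| * B (δ x)
      = (1 + ν * m) / 2 * (∫ x in Ioo a b, |f' x| / δ x)
        - lam / ((b - a) / 2) * (∫ x in Ioo a b, |f' x|) := by
    simp only [hrhs]
    rw [integral_sub (hf'δ.const_mul _) (hf'I.const_mul _), integral_const_mul,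
      integral_const_mul]
  have hR0 : 0 ≤ᵐ[volume.restrict (Ioo a b)] fun x => |f' x| * B (δ x) :=
    ae_restrict_of_forall_mem measurableSet_Ioo fun x hx =>
      mul_nonneg (abs_nonneg _) (hB0 _ (hδ x hx))
  have hG0 : 0 ≤ᵐ[volume.restrict (Ioo a b)] fun x => |f x| * V (δ x) :=
    ae_restrict_of_forall_mem measurableSet_Ioo fun x hx =>
      mul_nonneg (abs_nonneg _) (hV0 _ (hδ x hx))
  have hGm : AEStronglyMeasurable (fun x => |f x| * V (δ x)) (volume.restrict (Ioo a b)) :=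
    hfm.norm.mul (hVm.comp hδm).aestronglyMeasurable
  have hle : ∫⁻ x in Ioo a b, ENNReal.ofReal (|f x| * V (δ x))
      ≤ ENNReal.ofReal (∫ x in Ioo a b, |f' x| * B (δ x)) := by
    rw [ofReal_integral_eq_lintegral_ofReal hRint hR0]
    simpa only [ENNReal.ofReal_mul (abs_nonneg _), Real.enorm_eq_ofReal_abs] using hlint
  have hGint : IntegrableOn (fun x => |f x| * V (δ x)) (Ioo a b) :=
    ⟨hGm, (hasFiniteIntegral_iff_ofReal hG0).2 (hle.trans_lt ENNReal.ofReal_lt_top)⟩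
  have hGle : ∫ x in Ioo a b, |f x| * V (δ x) ≤ ∫ x in Ioo a b, |f' x| * B (δ x) := by
    rw [← ofReal_integral_eq_lintegral_ofReal hGint hG0] at hle
    exact (ENNReal.ofReal_le_ofReal_iff (integral_nonneg_of_ae hR0)).1 hle
  have hterm : ∀ x, |f x| * V (δ x) = (1 - ν ^ 2 * m ^ 2) / 4 * (|f x| / δ x ^ 2)
      + c ^ 2 / ((b - a) / 2) ^ m * (|f x| / δ x ^ ((2 : ℝ) - m)) := fun x => by
    simp only [hV]
    ring
  have hI1 : IntegrableOn (fun x => (1 - ν ^ 2 * m ^ 2) / 4 * (|f x| / δ x ^ 2)) (Ioo a b) := by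
    refine Integrable.mono' hGint
      (((hfm.norm.mul ((hδm.pow_const 2).inv).aestronglyMeasurable)).const_mul _)
      (ae_restrict_of_forall_mem measurableSet_Ioo fun x hx => ?_)
    have := hδ x hx
    rw [hterm, Real.norm_of_nonneg (by positivity)]
    exact le_add_of_nonneg_right (by positivity)
  have hI2 : IntegrableOn
      (fun x => c ^ 2 / ((b - a) / 2) ^ m * (|f x| / δ x ^ ((2 : ℝ) - m))) (Ioo a b) := by
    refine (hGint.sub hI1).congr (Eventually.of_forall fun x => ?_)
    simp only [Pi.sub_apply, hterm, add_sub_cancel_left]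
  rw [← hR, ← integral_const_mul, ← integral_const_mul, ← integral_add hI1 hI2]
  simpa only [hterm] using hGle
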